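/- Let w ∈ S_n and x_w ∈ N^w. Then x_w w⁻¹ admits a Gaussian decomposition, the element y = w⁻¹ [x_w w⁻¹]_+ w belongs to N_-(w), the product w·y admits a Gaussian decomposition, and [w·y]_+ = x_w. Moreover, y is the unique element of N_-(w) such that w·y ∈ G_0 and [w·y]_+ = x_w. -/

import Mathlib

open scoped Classical

namespace BruhatTNN

abbrev Mat (n : ℕ) := Matrix (Fin n) (Fin n) ℝ

/-- `x` is upper unitriangular. -/
def upperUni {n : ℕ} (x : Mat n) : Prop :=
  (∀ i, x i i = 1) ∧ ∀ i j : Fin n, j < i → x i j = 0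

/-- `x` is lower unitriangular. -/
def lowerUni {n : ℕ} (x : Mat n) : Prop :=
  (∀ i, x i i = 1) ∧ ∀ i j : Fin n, i < j → x i j = 0

/-- `x` is invertible upper triangular (`x ∈ B`). -/
def upperTriInv {n : ℕ} (x : Mat n) : Prop :=
  IsUnit x.det ∧ ∀ i j : Fin n, j < i → x i j = 0

/-- `x` is invertible lower triangular (`x ∈ B_-`). -/
def lowerTriInv {n : ℕ} (x : Mat n) : Prop :=
  IsUnit x.det ∧ ∀ i j : Fin n, i < j → x i j = 0

/-- `x` is invertible diagonal (`x ∈ H`). -/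
def diagInv {n : ℕ} (x : Mat n) : Prop :=
  IsUnit x.det ∧ ∀ i j : Fin n, i ≠ j → x i j = 0

/-- `x` admits a Gaussian decomposition (`x ∈ G_0`). -/
def hasGauss {n : ℕ} (x : Mat n) : Prop :=
  ∃ a d b : Mat n, lowerUni a ∧ diagInv d ∧ upperUni b ∧ x = a * d * b

/-- The factor `[x]_-` of the Gaussian decomposition (junk value `1` if none exists). -/
noncomputable def gaussMinus {n : ℕ} (x : Mat n) : Mat n :=
  if h : hasGauss x then h.choose else 1

/-- The factor `[x]_0` of the Gaussian decomposition (junk value `1` if none exists). -/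
noncomputable def gaussDiag {n : ℕ} (x : Mat n) : Mat n :=
  if h : hasGauss x then h.choose_spec.choose else 1

/-- The factor `[x]_+` of the Gaussian decomposition (junk value `1` if none exists). -/
noncomputable def gaussPlus {n : ℕ} (x : Mat n) : Mat n :=
  if h : hasGauss x then h.choose_spec.choose_spec.choose else 1

/-- The permutation matrix of `w`, with entry `1` in position `(w j, j)`. -/
def permMat {n : ℕ} (w : Equiv.Perm (Fin n)) : Mat n :=
  Matrix.of fun i j => if i = w j then (1 : ℝ) else 0

/-- The minor of `x` with row set `I` and column set `J` (taken in increasing order). -/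
def minorOf {n : ℕ} (x : Mat n) (k : ℕ) (I J : Finset (Fin n))
    (hI : I.card = k) (hJ : J.card = k) : ℝ :=
  Matrix.det (Matrix.of fun a b : Fin k => x (I.orderEmbOfFin hI a) (J.orderEmbOfFin hJ b))

/-- `x` is totally nonnegative: all its minors are nonnegative. -/
def totNonneg {n : ℕ} (x : Mat n) : Prop :=
  ∀ (k : ℕ) (I J : Finset (Fin n)) (hI : I.card = k) (hJ : J.card = k),
    0 ≤ minorOf x k I J hI hJ

/-- The Bruhat order on the symmetric group. -/
def bruhatLE {n : ℕ} (u v : Equiv.Perm (Fin n)) : Prop :=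
  ∀ i j : Fin n,
    (Finset.univ.filter fun k : Fin n => k ≤ i ∧ j ≤ u k).card ≤
    (Finset.univ.filter fun k : Fin n => k ≤ i ∧ j ≤ v k).card

/-- The double coset `B_- w B_-`. -/
def doubleCosetBm {n : ℕ} (w : Equiv.Perm (Fin n)) : Set (Mat n) :=
  {x | ∃ b₁ b₂ : Mat n, lowerTriInv b₁ ∧ lowerTriInv b₂ ∧ x = b₁ * permMat w * b₂}

/-- `N^w = B_- w B_- ∩ N`. -/
def Ncell {n : ℕ} (w : Equiv.Perm (Fin n)) : Set (Mat n) :=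
  {x | upperUni x ∧ x ∈ doubleCosetBm w}

/-- `N_-(w) = w⁻¹ N w ∩ N_-`. -/
def Nminus {n : ℕ} (w : Equiv.Perm (Fin n)) : Set (Mat n) :=
  {x | lowerUni x ∧ ∃ y : Mat n, upperUni y ∧ x = permMat w⁻¹ * y * permMat w}

/-- `N(w) = w⁻¹ N w ∩ N`. -/
def Ngrp {n : ℕ} (w : Equiv.Perm (Fin n)) : Set (Mat n) :=
  {x | upperUni x ∧ ∃ y : Mat n, upperUni y ∧ x = permMat w⁻¹ * y * permMat w}

/-- The totally positive cell `Y°_w = Y ∩ B_- w B_-`. -/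
def Ycirc {n : ℕ} (w : Equiv.Perm (Fin n)) : Set (Mat n) :=
  {x | upperUni x ∧ totNonneg x ∧ x ∈ doubleCosetBm w}

/-- `Y_{≥ u} = ⋃_{v ≥ u} Y°_v`. -/
def Yge {n : ℕ} (u : Equiv.Perm (Fin n)) : Set (Mat n) :=
  {x | ∃ v, bruhatLE u v ∧ x ∈ Ycirc v}

/-- `A = u⁻¹ [x u⁻¹]_+ u`. -/
noncomputable def Amat {n : ℕ} (u : Equiv.Perm (Fin n)) (x : Mat n) : Mat n :=
  permMat u⁻¹ * gaussPlus (x * permMat u⁻¹) * permMat u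

/-- The projection `π_u(x) = [u [u⁻¹ [x u⁻¹]_+ u]_-]_+`. -/
noncomputable def piMap {n : ℕ} (u : Equiv.Perm (Fin n)) (x : Mat n) : Mat n :=
  gaussPlus (permMat u * gaussMinus (Amat u x))

/-- `str(M)`: the sum of the matrix entries immediately above the main diagonal. -/
def strAbove {n : ℕ} (M : Mat n) : ℝ :=
  ∑ p : Fin n × Fin n, if (p.1 : ℕ) + 1 = (p.2 : ℕ) then M p.1 p.2 else 0

/-- The number of inversions (the length) of a permutation. -/
def invNum {n : ℕ} (w : Equiv.Perm (Fin n)) : ℕ :=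
  (Finset.univ.filter fun p : Fin n × Fin n => p.1 < p.2 ∧ w p.2 < w p.1).card

theorem lowerTriInv_iff {n : ℕ} {x : Mat n} :
    lowerTriInv x ↔ IsUnit x.det ∧ x.BlockTriangular OrderDual.toDual := Iff.rfl

theorem lowerTriInv.mul {n : ℕ} {x y : Mat n} (hx : lowerTriInv x) (hy : lowerTriInv y) :
    lowerTriInv (x * y) := by
  rw [lowerTriInv_iff] at *
  exact ⟨by rw [Matrix.det_mul]; exact hx.1.mul hy.1, hx.2.mul hy.2⟩

theorem lowerTriInv.inv {n : ℕ} {x : Mat n} (hx : lowerTriInv x) : lowerTriInv x⁻¹ := by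
  rw [lowerTriInv_iff] at *
  have := x.invertibleOfIsUnitDet hx.1
  exact ⟨Matrix.isUnit_nonsing_inv_det x hx.1,
    Matrix.blockTriangular_inv_of_blockTriangular hx.2⟩

theorem lowerTriInv_of_diag_ne_zero {n : ℕ} {x : Mat n} (hd : ∀ i, x i i ≠ 0)
    (hx : ∀ i j : Fin n, i < j → x i j = 0) : lowerTriInv x := by
  refine ⟨?_, hx⟩
  rw [Matrix.det_of_isLowerTriangular x hx, isUnit_iff_ne_zero]
  exact Finset.prod_ne_zero_iff.2 fun i _ => hd i

theorem lowerTriInv.diag_ne_zero {n : ℕ} {x : Mat n} (hx : lowerTriInv x) (i : Fin n) :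
    x i i ≠ 0 := by
  have h := hx.1
  rw [Matrix.det_of_isLowerTriangular x hx.2, isUnit_iff_ne_zero] at h
  exact Finset.prod_ne_zero_iff.1 h i (Finset.mem_univ i)

theorem upperUni.isUnit_det {n : ℕ} {x : Mat n} (hx : upperUni x) : IsUnit x.det := by
  rw [Matrix.det_of_isUpperTriangular (M := x) fun i j h => hx.2 i j h]
  simp [hx.1]

theorem lowerUni.lowerTriInv {n : ℕ} {x : Mat n} (hx : lowerUni x) : lowerTriInv x :=
  lowerTriInv_of_diag_ne_zero (fun i => by simp [hx.1 i]) hx.2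

theorem diagInv.lowerTriInv {n : ℕ} {x : Mat n} (hx : diagInv x) : lowerTriInv x :=
  ⟨hx.1, fun i j h => hx.2 i j h.ne⟩

/-- The upper unitriangular factor of a lower-upper factorization is unique. -/
theorem upperUni_eq_of_mul_eq {n : ℕ} {b b' u u' : Mat n} (hb : lowerTriInv b)
    (hb' : lowerTriInv b') (hu : upperUni u) (hu' : upperUni u') (h : b * u = b' * u') :
    u = u' := by
  set c := b'⁻¹ * b with hc
  have hcl : lowerTriInv c := hb'.inv.mul hb
  have hcu : c * u = u' := by
    rw [hc, Matrix.mul_assoc, h, Matrix.nonsing_inv_mul_cancel_left _ _ hb'.1]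
  have := u.invertibleOfIsUnitDet hu.isUnit_det
  have hinv : (u⁻¹).BlockTriangular id :=
    Matrix.blockTriangular_inv_of_blockTriangular fun i j h => hu.2 i j h
  have hc' : c = u' * u⁻¹ := by
    rw [← hcu, Matrix.mul_nonsing_inv_cancel_right _ _ hu.isUnit_det]
  have hcup : c.BlockTriangular id := by
    rw [hc']
    exact Matrix.BlockTriangular.mul (fun i j h => hu'.2 i j h) hinv
  have hoff : ∀ i j, i ≠ j → c i j = 0 := fun i j hij =>
    hij.lt_or_gt.elim (hcl.2 i j) fun h => hcup h
  have hdiag : c = Matrix.diagonal fun i => c i i := by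
    ext i j
    by_cases hij : i = j
    · subst hij; simp
    · rw [hoff i j hij, Matrix.diagonal_apply_ne _ hij]
  have hone : ∀ i, c i i = 1 := fun i => by
    have := congrFun (congrFun hcu i) i
    rw [hdiag, Matrix.diagonal_mul, hu.1, hu'.1, mul_one] at this
    exact this
  rw [← hcu, hdiag]
  simp [hone]

theorem hasGauss_mul {n : ℕ} {b u : Mat n} (hb : lowerTriInv b) (hu : upperUni u) :
    hasGauss (b * u) := by
  have hne := hb.diag_ne_zero
  refine ⟨b * Matrix.diagonal fun i => (b i i)⁻¹, Matrix.diagonal fun i => b i i, u,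
    ⟨fun i => ?_, fun i j hij => ?_⟩, ⟨?_, fun i j hij => Matrix.diagonal_apply_ne _ hij⟩, hu, ?_⟩
  · simp [hne i]
  · simp [hb.2 i j hij]
  · rw [Matrix.det_diagonal, isUnit_iff_ne_zero]
    exact Finset.prod_ne_zero_iff.2 fun i _ => hne i
  · rw [Matrix.mul_assoc b, Matrix.diagonal_mul_diagonal]
    simp [hne]

theorem exists_eq_mul_gaussPlus {n : ℕ} {x : Mat n} (h : hasGauss x) :
    ∃ b, lowerTriInv b ∧ upperUni (gaussPlus x) ∧ x = b * gaussPlus x := by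
  obtain ⟨ha, hd, hu, hx⟩ := h.choose_spec.choose_spec.choose_spec
  rw [gaussPlus, dif_pos h]
  exact ⟨_, ha.lowerTriInv.mul hd.lowerTriInv, hu, hx⟩

theorem gaussPlus_mul {n : ℕ} {b u : Mat n} (hb : lowerTriInv b) (hu : upperUni u) :
    gaussPlus (b * u) = u := by
  obtain ⟨b', hb', hu', h⟩ := exists_eq_mul_gaussPlus (hasGauss_mul hb hu)
  exact (upperUni_eq_of_mul_eq hb hb' hu hu' h).symm

theorem permMat_mul_apply {n : ℕ} (w : Equiv.Perm (Fin n)) (x : Mat n) (i j : Fin n) :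
    (permMat w * x) i j = x (w⁻¹ i) j := by
  simp [permMat, Matrix.mul_apply, ← Equiv.Perm.inv_eq_iff_eq]

theorem mul_permMat_apply {n : ℕ} (w : Equiv.Perm (Fin n)) (x : Mat n) (i j : Fin n) :
    (x * permMat w) i j = x i (w j) := by
  simp [permMat, Matrix.mul_apply]

theorem permMat_mul_permMat_inv {n : ℕ} (w : Equiv.Perm (Fin n)) :
    permMat w * permMat w⁻¹ = 1 := by
  ext i j
  rw [permMat_mul_apply]
  simp [permMat, Matrix.one_apply]

theorem permMat_inv_mul_permMat {n : ℕ} (w : Equiv.Perm (Fin n)) :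
    permMat w⁻¹ * permMat w = 1 :=
  mul_eq_one_comm.1 (permMat_mul_permMat_inv w)

/-- A matrix that is triangular with respect to the strict order induced by `f`, with nonzero
diagonal, has a lower-upper factorization whose upper factor has the same support pattern. -/
theorem exists_lower_mul_upper {n : ℕ} (f : Fin n → ℕ) (x : Mat n) (hd : ∀ i, x i i ≠ 0)
    (hx : ∀ i j, i ≠ j → ¬ f j < f i → x i j = 0) :
    ∃ l u : Mat n, lowerTriInv l ∧ upperUni u ∧
      (∀ i j, i ≠ j → ¬ f j < f i → u i j = 0) ∧ x = l * u := by
  induction n with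
  | zero =>
    exact ⟨1, 1, ⟨by simp, fun i => i.elim0⟩, ⟨fun i => i.elim0, fun i => i.elim0⟩,
      fun i => i.elim0, Matrix.ext fun i => i.elim0⟩
  | succ n ih =>
    have hprod : ∀ i j : Fin n, ¬ f j.succ < f i.succ → x i.succ 0 * x 0 j.succ = 0 := by
      intro i j hij
      by_cases h0 : f 0 < f i.succ
      · rw [hx 0 j.succ (Fin.succ_ne_zero j).symm fun h => hij (h.trans h0), mul_zero]
      · rw [hx i.succ 0 (Fin.succ_ne_zero i) h0, zero_mul]
    obtain ⟨l, u, hl, hu, hup, hlu⟩ := ih (fun i => f i.succ)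
      (Matrix.of fun i j => x i.succ j.succ - x i.succ 0 * x 0 j.succ / x 0 0)
      (fun i => by simp [hprod i i (lt_irrefl _), hd])
      (fun i j hij hf => by
        simp [hprod i j hf, hx i.succ j.succ (fun h => hij (Fin.succ_injective _ h)) hf])
    refine ⟨Matrix.of fun i j => Fin.cases (x i 0) (fun j => Fin.cases 0 (fun i => l i j) i) j,
      Matrix.of fun i j => Fin.cases (x 0 j / x 0 0) (fun i => Fin.cases 0 (fun j => u i j) j) i,
      lowerTriInv_of_diag_ne_zero ?_ ?_, ⟨?_, ?_⟩, ?_, ?_⟩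
    · intro i
      cases i using Fin.cases with
      | zero => simpa using hd 0
      | succ i => simpa using hl.diag_ne_zero i
    · intro i j hij
      cases j using Fin.cases with
      | zero => simp at hij
      | succ j =>
        cases i using Fin.cases with
        | zero => simp
        | succ i => simpa using hl.2 i j (Fin.succ_lt_succ_iff.1 hij)
    · intro i
      cases i using Fin.cases with
      | zero => simpa using div_self (hd 0)
      | succ i => simpa using hu.1 i
    · intro i j hij
      cases i using Fin.cases with
      | zero => simp at hij
      | succ i =>
        cases j using Fin.cases with
        | zero => simp
        | succ j => simpa using hu.2 i j (Fin.succ_lt_succ_iff.1 hij)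
    · intro i j hij hf
      cases i using Fin.cases with
      | zero => simp [hx 0 j hij hf]
      | succ i =>
        cases j using Fin.cases with
        | zero => simp
        | succ j => simpa using hup i j (fun h => hij (congrArg Fin.succ h)) hf
    · ext i j
      have h0 := hd 0
      rw [Matrix.mul_apply, Fin.sum_univ_succ]
      cases i using Fin.cases with
      | zero => simp [mul_div_cancel₀, h0]
      | succ i =>
        cases j using Fin.cases with
        | zero => simp [h0]
        | succ j =>
          have := congrFun (congrFun hlu i) j
          rw [Matrix.mul_apply] at this
          simp only [Matrix.of_apply, Fin.cases_zero, Fin.cases_succ] at this ⊢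
          rw [← this]
          ring

theorem statement2 (n : ℕ) (hn : 1 ≤ n) (w : Equiv.Perm (Fin n)) (xw : Mat n)
    (hxw : xw ∈ Ncell w) :
    hasGauss (xw * permMat w⁻¹) ∧
    (permMat w⁻¹ * gaussPlus (xw * permMat w⁻¹) * permMat w) ∈ Nminus w ∧
    hasGauss (permMat w * (permMat w⁻¹ * gaussPlus (xw * permMat w⁻¹) * permMat w)) ∧
    gaussPlus (permMat w * (permMat w⁻¹ * gaussPlus (xw * permMat w⁻¹) * permMat w)) = xw ∧
    (∀ y' ∈ Nminus w, hasGauss (permMat w * y') → gaussPlus (permMat w * y') = xw →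
      y' = permMat w⁻¹ * gaussPlus (xw * permMat w⁻¹) * permMat w) := by
  obtain ⟨hxu, b₁, b₂, hb₁, hb₂, hx⟩ := hxw
  have hw := permMat_mul_permMat_inv w
  have hw' := permMat_inv_mul_permMat w
  obtain ⟨l, q, hl, hq, hqp, hlq⟩ := exists_lower_mul_upper (fun i => (w⁻¹ i : ℕ))
    (permMat w * b₂ * permMat w⁻¹)
    (fun i => by
      rw [mul_permMat_apply, permMat_mul_apply]
      exact hb₂.diag_ne_zero _)
    (fun i j hij hf => by
      rw [mul_permMat_apply, permMat_mul_apply]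
      exact hb₂.2 _ _ (lt_of_le_of_ne (not_lt.1 hf) fun h => hij (w⁻¹.injective h)))
  have hbl := hb₁.mul hl
  have hfac : xw * permMat w⁻¹ = b₁ * l * q := by
    rw [Matrix.mul_assoc b₁, ← hlq, hx]
    simp only [Matrix.mul_assoc]
  have hconj : permMat w * (permMat w⁻¹ * q * permMat w) = q * permMat w := by
    rw [← Matrix.mul_assoc, ← Matrix.mul_assoc, hw, Matrix.one_mul]
  have hxq : q * permMat w = (b₁ * l)⁻¹ * xw := by
    have : xw = b₁ * l * (q * permMat w) := by
      rw [← Matrix.mul_assoc, ← hfac, Matrix.mul_assoc, hw', Matrix.mul_one]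
    rw [this, Matrix.nonsing_inv_mul_cancel_left _ _ hbl.1]
  rw [show gaussPlus (xw * permMat w⁻¹) = q by rw [hfac, gaussPlus_mul hbl hq], hconj, hxq]
  refine ⟨hfac ▸ hasGauss_mul hbl hq, ⟨⟨fun i => ?_, fun i j hij => ?_⟩, q, hq, rfl⟩,
    hasGauss_mul hbl.inv hxu, gaussPlus_mul hbl.inv hxu, ?_⟩
  · rw [mul_permMat_apply, permMat_mul_apply]
    exact hq.1 _
  · rw [mul_permMat_apply, permMat_mul_apply, inv_inv]
    exact hqp _ _ (fun h => hij.ne (w.injective h)) (by simpa using hij.le)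
  · rintro _ ⟨-, u, hu, rfl⟩ hg hp
    obtain ⟨b, hb, -, h⟩ := exists_eq_mul_gaussPlus hg
    rw [hp] at h
    have hu' : u = b * (b₁ * l) * q := by
      rw [Matrix.mul_assoc b, ← hfac, ← Matrix.mul_assoc, ← h]
      simp only [Matrix.mul_assoc, hw, Matrix.mul_one]
      rw [← Matrix.mul_assoc, hw, Matrix.one_mul]
    rw [upperUni_eq_of_mul_eq (lowerUni.lowerTriInv (x := 1) ⟨by simp, fun i j h => by
      simp [h.ne]⟩) (hb.mul hbl) hu hq (by rw [Matrix.one_mul, hu'])]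

end BruhatTNN
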